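/- Let u : ℝ → ℝ be a bounded weak solution of −|u′|^α u″ = f_{a,A}(u) on ℝ with u(0) = 0, lim_{x→+∞} u(x) = 1 and lim_{x→−∞} u(x) = −1. Then |u′(0)|^{2+α} = (2+α) · ∫₀¹ f_{a,A}(s) ds and |u′(0)|^{2+α} = −(2+α) · ∫_{−1}^{0} f_{a,A}(s) ds. In particular, ∫_{−1}^{1} f_{a,A}(s) ds = 0; this condition on f is necessary for the existence of such a heteroclinic weak solution. -/

import Mathlib

noncomputable section

open Real Filter Topology intervalIntegral

/-- The normalized nonlinearity `f_{a,A}`: `f/a` where `f > 0`, `f/A` where `f < 0`,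
and `0` where `f = 0`. -/
def faA (a A : ℝ) (f : ℝ → ℝ) (t : ℝ) : ℝ :=
  if 0 < f t then f t / a else if f t < 0 then f t / A else 0

/-- `u` is a weak solution of `-|u'|^α u'' = f_{a,A}(u)` on all of `ℝ`:
`u` is C¹ and `x ↦ |u'|^α u'` is differentiable with (continuous) derivative
`-(1+α)·f_{a,A}(u(x))`. -/
def IsWeakSolR (α a A : ℝ) (f : ℝ → ℝ) (u : ℝ → ℝ) : Prop :=
  Differentiable ℝ u ∧ Continuous (deriv u) ∧
  ∀ x : ℝ, HasDerivAt (fun y => |deriv u y| ^ α * deriv u y)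
    (-(1 + α) * faA a A f (u x)) x

lemma faA_eq_max_add_min (a A : ℝ) (f : ℝ → ℝ) (t : ℝ) :
    faA a A f t = max (f t) 0 / a + min (f t) 0 / A := by
  unfold faA
  rcases lt_trichotomy (f t) 0 with h | h | h
  · simp [h, h.le, not_lt.2 h.le]
  · simp [h]
  · simp [h, h.le]

lemma continuous_faA (a A : ℝ) {f : ℝ → ℝ} (hf : Continuous f) : Continuous (faA a A f) := by
  have h : faA a A f = fun t => max (f t) 0 / a + min (f t) 0 / A :=
    funext (faA_eq_max_add_min a A f)
  rw [h]
  fun_prop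

lemma abs_abs_rpow_mul_self {α : ℝ} (hα : -1 < α) (v : ℝ) :
    |(|v| ^ α * v)| = |v| ^ (1 + α) := by
  rcases eq_or_ne v 0 with rfl | hv
  · simp [Real.zero_rpow (show 1 + α ≠ 0 by linarith)]
  · have hv' : 0 < |v| := abs_pos.2 hv
    rw [add_comm, Real.rpow_add_one hv'.ne', abs_mul,
      abs_of_nonneg (Real.rpow_nonneg hv'.le α)]

/-- The map `w ↦ |w| ^ (p - 2) * w` with `p = (2 + α) / (1 + α)` inverts `v ↦ |v| ^ α * v`. -/
lemma abs_rpow_mul_self_leftInverse {α : ℝ} (hα : -1 < α) (v : ℝ) :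
    |(|v| ^ α * v)| ^ ((2 + α) / (1 + α) - 2) * (|v| ^ α * v) = v := by
  rcases eq_or_ne v 0 with rfl | hv
  · simp
  · have hv' : 0 < |v| := abs_pos.2 hv
    have h1 : 1 + α ≠ 0 := by linarith
    rw [abs_abs_rpow_mul_self hα, ← Real.rpow_mul hv'.le, ← mul_assoc, ← Real.rpow_add hv']
    have h2 : (1 + α) * ((2 + α) / (1 + α) - 2) + α = 0 := by field_simp; ring
    rw [h2, Real.rpow_zero, one_mul]

lemma IsWeakSolR.hasDerivAt_abs_deriv_rpow {α a A : ℝ} {f u : ℝ → ℝ} (hα : -1 < α)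
    (hu : IsWeakSolR α a A f u) (x : ℝ) :
    HasDerivAt (fun y => |deriv u y| ^ (2 + α))
      (-((2 + α) * (faA a A f (u x) * deriv u x))) x := by
  have h1 : 0 < 1 + α := by linarith
  have hp : 1 < (2 + α) / (1 + α) := by rw [lt_div_iff₀ h1]; linarith
  have h := (hasDerivAt_abs_rpow (|deriv u x| ^ α * deriv u x) hp).comp
    (h := fun y => |deriv u y| ^ α * deriv u y) x (hu.2.2 x)
  rw [mul_assoc ((2 + α) / (1 + α)), abs_rpow_mul_self_leftInverse hα] at h
  refine (h.congr_of_eventuallyEq (.of_forall fun y => ?_)).congr_deriv ?_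
  · simp only [Function.comp_apply]
    rw [abs_abs_rpow_mul_self hα, ← Real.rpow_mul (abs_nonneg _), mul_div_cancel₀ _ h1.ne']
  · field_simp

/-- Conservation of energy. -/
lemma IsWeakSolR.energy_eq {α a A : ℝ} {f u : ℝ → ℝ} (hα : -1 < α) (hf : Continuous f)
    (hu : IsWeakSolR α a A f u) (x y : ℝ) :
    |deriv u x| ^ (2 + α) + (2 + α) * (∫ s in (0 : ℝ)..u x, faA a A f s) =
      |deriv u y| ^ (2 + α) + (2 + α) * ∫ s in (0 : ℝ)..u y, faA a A f s := by
  have hg := continuous_faA a A hf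
  have h (z : ℝ) : HasDerivAt
      (fun x => |deriv u x| ^ (2 + α) + (2 + α) * ∫ s in (0 : ℝ)..u x, faA a A f s) 0 z := by
    have hG : HasDerivAt (fun t => ∫ s in (0 : ℝ)..t, faA a A f s) (faA a A f (u z)) (u z) :=
      (hg.integral_hasStrictDerivAt 0 (u z)).hasDerivAt
    have hGu := hG.comp z (hu.1 z).hasDerivAt
    exact ((hu.hasDerivAt_abs_deriv_rpow hα z).add (hGu.const_mul (2 + α))).congr_deriv
      (neg_add_cancel _)
  exact is_const_of_deriv_eq_zero (fun z => (h z).differentiableAt) (fun z => (h z).deriv) x y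

/-- If `u` converges at infinity and a positive power of `|u'|` converges, the latter limit is
zero. -/
lemma eq_zero_of_tendsto_abs_deriv_rpow {u : ℝ → ℝ} {l L q : ℝ} (hq : 0 < q)
    (hu : Differentiable ℝ u) (hl : Tendsto u atTop (𝓝 l))
    (hL : Tendsto (fun x => |deriv u x| ^ q) atTop (𝓝 L)) : L = 0 := by
  have hmv (x : ℝ) : ∃ ξ ∈ Set.Ioo x (x + 1), deriv u ξ = u (x + 1) - u x := by
    obtain ⟨ξ, hξ, h⟩ := exists_deriv_eq_slope u (lt_add_one x) hu.continuous.continuousOn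
      hu.differentiableOn
    exact ⟨ξ, hξ, by simpa using h⟩
  choose ξ hξ hd using hmv
  have hξt : Tendsto ξ atTop atTop := tendsto_atTop_mono (fun x => (hξ x).1.le) tendsto_id
  have h0 : Tendsto (fun x => u (x + 1) - u x) atTop (𝓝 0) := by
    simpa using (hl.comp (tendsto_atTop_add_const_right atTop (1 : ℝ) tendsto_id)).sub hl
  have h1 : Tendsto (fun x => |deriv u (ξ x)| ^ q) atTop (𝓝 0) := by
    simpa [hd, Real.zero_rpow hq.ne'] using h0.abs.rpow_const (p := q) (Or.inr hq.le)
  exact tendsto_nhds_unique (hL.comp hξt) h1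

lemma eq_zero_of_tendsto_abs_deriv_rpow_atBot {u : ℝ → ℝ} {l L q : ℝ} (hq : 0 < q)
    (hu : Differentiable ℝ u) (hl : Tendsto u atBot (𝓝 l))
    (hL : Tendsto (fun x => |deriv u x| ^ q) atBot (𝓝 L)) : L = 0 := by
  refine eq_zero_of_tendsto_abs_deriv_rpow (u := fun x => u (-x)) hq
    (hu.comp differentiable_neg) (hl.comp tendsto_neg_atTop_atBot) ?_
  simpa [deriv_comp_neg, Function.comp_def] using hL.comp tendsto_neg_atTop_atBot

/-- The kinetic energy at a zero of `u` is `(2 + α)` times the potential at a limit of `u`. -/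
lemma IsWeakSolR.tendsto_abs_deriv_rpow {α a A l : ℝ} {f u : ℝ → ℝ} {F : Filter ℝ}
    (hα : -1 < α) (hf : Continuous f) (hu : IsWeakSolR α a A f u) (hu0 : u 0 = 0)
    (hl : Tendsto u F (𝓝 l)) :
    Tendsto (fun x => |deriv u x| ^ (2 + α)) F
      (𝓝 (|deriv u 0| ^ (2 + α) - (2 + α) * ∫ s in (0 : ℝ)..l, faA a A f s)) := by
  have hg := continuous_faA a A hf
  have hG : Tendsto (fun x => ∫ s in (0 : ℝ)..u x, faA a A f s) F
      (𝓝 (∫ s in (0 : ℝ)..l, faA a A f s)) :=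
    (hg.integral_hasStrictDerivAt 0 l).hasDerivAt.continuousAt.tendsto.comp hl
  refine ((hG.const_mul (2 + α)).const_sub (|deriv u 0| ^ (2 + α))).congr fun x => ?_
  have h := hu.energy_eq hα hf x 0
  rw [hu0, integral_same, mul_zero, add_zero] at h
  linarith

/-- **Necessity of the balance condition** (Remark 5.1). If `u` is a bounded weak
solution of `-|u'|^α u'' = f_{a,A}(u)` on `ℝ` with `u(0) = 0`, `u(±∞) = ±1`, then
`|u'(0)|^{2+α} = (2+α)∫₀¹ f_{a,A}` and `|u'(0)|^{2+α} = -(2+α)∫_{-1}^0 f_{a,A}`;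
in particular `∫_{-1}^1 f_{a,A}(s) ds = 0`. -/
theorem balance_condition_necessary
    (α a A : ℝ) (hα : -1 < α) (ha : 0 < a) (haA : a ≤ A)
    (f : ℝ → ℝ) (hf : ContDiff ℝ 1 f)
    (hfm1 : f (-1) = 0) (hf0 : f 0 = 0) (hf1 : f 1 = 0)
    (hfpos : ∀ t ∈ Set.Ioo (0:ℝ) 1, 0 < f t)
    (hfneg : ∀ t ∈ Set.Ioo (-1:ℝ) 0, f t < 0)
    (hfge : ∀ t : ℝ, t ≤ -1 → 0 ≤ f t)
    (hfle : ∀ t : ℝ, 1 ≤ t → f t ≤ 0)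
    (u : ℝ → ℝ) (hu : IsWeakSolR α a A f u)
    (hubd : ∃ K : ℝ, ∀ x, |u x| ≤ K)
    (hu0 : u 0 = 0)
    (hlimPos : Tendsto u atTop (𝓝 1)) (hlimNeg : Tendsto u atBot (𝓝 (-1))) :
    |deriv u 0| ^ (2 + α) = (2 + α) * ∫ s in (0:ℝ)..1, faA a A f s ∧
    |deriv u 0| ^ (2 + α) = -((2 + α) * ∫ s in (-1:ℝ)..0, faA a A f s) ∧
    (∫ s in (-1:ℝ)..1, faA a A f s) = 0 := by
  have hq : 0 < 2 + α := by linarith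
  have hfc := hf.continuous
  have hg := continuous_faA a A hfc
  have hpos := eq_zero_of_tendsto_abs_deriv_rpow hq hu.1 hlimPos
    (hu.tendsto_abs_deriv_rpow hα hfc hu0 hlimPos)
  have hneg := eq_zero_of_tendsto_abs_deriv_rpow_atBot hq hu.1 hlimNeg
    (hu.tendsto_abs_deriv_rpow hα hfc hu0 hlimNeg)
  rw [integral_symm] at hneg
  have hadd := integral_add_adjacent_intervals (hg.intervalIntegrable (μ := MeasureTheory.volume)
    (-1) 0) (hg.intervalIntegrable 0 1)
  refine ⟨by linarith, by linarith, ?_⟩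
  rw [← hadd]
  refine (mul_eq_zero.1 (?_ : (2 + α) * _ = 0)).resolve_left hq.ne'
  linarith
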